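/- Let 0 < β ≤ 1 and C₀ > 0, let S₀ ⊆ {1, …, p} with |S₀| = s ≥ 1, let G : ℝ^s → ℝ satisfy |G(z) − G(z')| ≤ C₀‖z − z'‖₂^β for all z, z', and fix a constant C₃ > 0. Then there exists a constant C > 0 such that for every integer n ≥ 1 and every m with 0 < m ≤ C₃·n^{1/s}, taking w = d = ⌈n^{(2β+s)/(8β)}⌉, there is a function g : ℝ^p → ℝ computed by a ReLU feedforward network of width 3^{s+3}·max{s⌊w^{1/s}⌋, w+1} and depth 12d + 14 + 2s, depending on x only through x_{S₀}, such that sup over x ∈ ℝ^p with x_{S₀} ∈ [−m, m]^s of |G(x_{S₀}) − g(x)| ≤ C·n^{−1/2}. -/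

import Mathlib

open scoped Matrix
noncomputable section

/-- Euclidean norm of a finite real vector. -/
def euclNorm {n : ℕ} (v : Fin n → ℝ) : ℝ := Real.sqrt (∑ i, v i ^ 2)

/-- Forward pass of a ReLU network with biases: `fwd dims A b l x` is the `l`-th hidden layer,
i.e. `σ(A_l(⋯σ(A_1(x))⋯))`. -/
def fwd (dims : ℕ → ℕ)
    (A : ∀ l, Matrix (Fin (dims (l + 1))) (Fin (dims l)) ℝ)
    (b : ∀ l, Fin (dims (l + 1)) → ℝ) :
    (l : ℕ) → (Fin (dims 0) → ℝ) → Fin (dims l) → ℝ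
  | 0 => fun x => x
  | (l + 1) => fun x i => max (((A l).mulVec (fwd dims A b l x) + b l) i) 0

/-- `IsReluNet Wd D g`: `g : ℝ^p → ℝ` is computed by a ReLU feedforward network of width `Wd`
and depth `D`. -/
def IsReluNet {p : ℕ} (Wd D : ℕ) (g : (Fin p → ℝ) → ℝ) : Prop :=
  ∃ dims : ℕ → ℕ, ∃ h0 : dims 0 = p, ∃ hD : dims (D + 1) = 1,
    (∀ l, 1 ≤ l → l ≤ D → dims l ≤ Wd) ∧
    ∃ (A : ∀ l, Matrix (Fin (dims (l + 1))) (Fin (dims l)) ℝ)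
      (b : ∀ l, Fin (dims (l + 1)) → ℝ),
      ∀ x : Fin p → ℝ,
        g x = ((A D).mulVec (fwd dims A b D (fun j => x (Fin.cast h0 j))) + b D)
            (Fin.cast hD.symm ⟨0, Nat.one_pos⟩)

/-- The subvector `x_{S}` of the coordinates of `x` indexed by `S` (in increasing order). -/
def subvec {p s : ℕ} (S : Finset (Fin p)) (hs : S.card = s) (x : Fin p → ℝ) :
    Fin s → ℝ :=
  fun i => x ((S.orderIsoOfFin hs i : S) : Fin p)

/-- The common width/depth parameter `w = d = ⌈n^{(2β+s)/(8β)}⌉`. -/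
def wdParam (n s : ℕ) (β : ℝ) : ℕ := ⌈(n : ℝ) ^ ((2 * β + s) / (8 * β))⌉₊

section Reach

variable {X Y : Type*}

/-- The space of functions that are affine in the functions of `S`. -/
def affHull (S : Set (X → ℝ)) : Submodule ℝ (X → ℝ) := Submodule.span ℝ (insert 1 S)

theorem one_mem_affHull (S : Set (X → ℝ)) : (1 : X → ℝ) ∈ affHull S :=
  Submodule.subset_span (Set.mem_insert _ _)

theorem subset_affHull (S : Set (X → ℝ)) : S ⊆ affHull S :=
  (Set.subset_insert _ _).trans Submodule.subset_span

theorem affHull_le {S : Set (X → ℝ)} {V : Submodule ℝ (X → ℝ)} (h1 : (1 : X → ℝ) ∈ V)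
    (hS : S ⊆ V) : affHull S ≤ V :=
  Submodule.span_le.2 (Set.insert_subset h1 hS)

theorem affHull_mono {S T : Set (X → ℝ)} (h : S ⊆ T) : affHull S ≤ affHull T :=
  Submodule.span_mono (Set.insert_subset_insert h)

theorem const_mem {V : Submodule ℝ (X → ℝ)} (h1 : (1 : X → ℝ) ∈ V) (c : ℝ) :
    (fun _ : X => c) ∈ V := by
  have := V.smul_mem c h1
  convert this using 1
  ext; simp

theorem map_affHull (φ : Y → X) (S : Set (X → ℝ)) :
    (affHull S).map (LinearMap.funLeft ℝ ℝ φ) = affHull ((fun f => f ∘ φ) '' S) := by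
  rw [affHull, Submodule.map_span, Set.image_insert_eq]
  rfl

/-- Componentwise positive part of a family of functions. -/
def reluFam {ι : Type*} (h : ι → X → ℝ) : ι → X → ℝ := fun i x => max (h i x) 0

/-- `Reach W D V U`: starting from features in `V`, the functions in `U` can be computed as affine
functions of the last of `D` ReLU layers, each having at most `W` neurons. -/
def Reach (W : ℕ) : ℕ → Submodule ℝ (X → ℝ) → Submodule ℝ (X → ℝ) → Prop
  | 0, V, U => U ≤ V
  | D + 1, V, U => ∃ h : Fin W → X → ℝ, (∀ i, h i ∈ V) ∧
      Reach W D (affHull (Set.range (reluFam h))) U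

namespace Reach

variable {W W₁ W₂ D D₁ D₂ : ℕ} {V V' U U' T : Submodule ℝ (X → ℝ)}

theorem mono_left (h : Reach W D V U) (hV : V ≤ V') : Reach W D V' U := by
  cases D with
  | zero => exact le_trans h hV
  | succ D =>
    obtain ⟨f, hf, hr⟩ := h
    exact ⟨f, fun i => hV (hf i), hr⟩

theorem mono_right (h : Reach W D V U) (hU : U' ≤ U) : Reach W D V U' := by
  induction D generalizing V with
  | zero => exact le_trans hU h
  | succ D ih =>
    obtain ⟨f, hf, hr⟩ := h
    exact ⟨f, hf, ih hr⟩

theorem mono_width (h : Reach W D V U) (hW : W ≤ W') : Reach W' D V U := by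
  induction D generalizing V with
  | zero => exact h
  | succ D ih =>
    obtain ⟨f, hf, hr⟩ := h
    refine ⟨fun i => if hi : i.1 < W then f ⟨i, hi⟩ else 0, fun i => ?_,
      (ih hr).mono_left (affHull_mono ?_)⟩
    · dsimp only
      split_ifs
      exacts [hf _, V.zero_mem]
    · rintro _ ⟨i, rfl⟩
      exact ⟨⟨i, i.2.trans_le hW⟩, by ext; simp [reluFam]⟩

theorem trans (h : Reach W D₁ V U) (h' : Reach W D₂ U T) : Reach W (D₁ + D₂) V T := by
  induction D₁ generalizing V with
  | zero => simpa using h'.mono_left h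
  | succ D ih =>
    obtain ⟨f, hf, hr⟩ := h
    rw [Nat.add_right_comm]
    exact ⟨f, hf, ih hr⟩

theorem par (h : Reach W₁ D V U) (h' : Reach W₂ D V U') :
    Reach (W₁ + W₂) D V (U ⊔ U') := by
  induction D generalizing V with
  | zero => exact sup_le h h'
  | succ D ih =>
    obtain ⟨f, hf, hr⟩ := h
    obtain ⟨f', hf', hr'⟩ := h'
    refine ⟨Fin.append f f', fun i => ?_, ih (hr.mono_left (affHull_mono ?_))
      (hr'.mono_left (affHull_mono ?_))⟩
    · refine Fin.addCases (fun i => ?_) (fun i => ?_) i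
      · simpa using hf i
      · simpa using hf' i
    · rintro _ ⟨i, rfl⟩
      exact ⟨Fin.castAdd _ i, by ext; simp [reluFam]⟩
    · rintro _ ⟨i, rfl⟩
      exact ⟨Fin.natAdd _ i, by ext; simp [reluFam]⟩

theorem par_iSup {ι : Type*} [Fintype ι] {U : ι → Submodule ℝ (X → ℝ)}
    (h : ∀ i, Reach W D V (U i)) :
    Reach (Fintype.card ι * W) D V (⨆ i, U i) := by
  classical
  have bot : ∀ (D : ℕ) (V : Submodule ℝ (X → ℝ)), Reach 0 D V ⊥ := by
    intro D
    induction D with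
    | zero => exact fun V => bot_le
    | succ D ih => exact fun V => ⟨Fin.elim0, fun i => i.elim0, ih _⟩
  have key : ∀ t : Finset ι, Reach (t.card * W) D V (⨆ i ∈ t, U i) := by
    intro t
    induction t using Finset.induction_on with
    | empty => simpa using bot D V
    | insert a t ha ih =>
      rw [Finset.card_insert_of_notMem ha, Finset.iSup_insert, Nat.succ_mul, Nat.add_comm]
      exact (h a).par ih
  simpa using key Finset.univ

theorem layer {ι : Type*} [Fintype ι] (h : ι → X → ℝ) (hι : Fintype.card ι ≤ W)
    (hV : ∀ i, h i ∈ V) : Reach W 1 V (affHull (Set.range (reluFam h))) := by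
  refine mono_width (W := Fintype.card ι)
    ⟨fun i => h ((Fintype.equivFin ι).symm i), fun i => hV _, affHull_mono ?_⟩ hι
  rintro _ ⟨i, rfl⟩
  exact ⟨Fintype.equivFin ι i, by ext; simp [reluFam]⟩

theorem carry {g : X → ℝ} (h1 : (1 : X → ℝ) ∈ V) (hg : g ∈ V) :
    Reach 2 D V (affHull {g}) := by
  induction D generalizing V with
  | zero => exact affHull_le h1 (by simpa using hg)
  | succ D ih =>
    refine ⟨![g, -g], fun i => ?_, ih (one_mem_affHull _) ?_⟩
    · fin_cases i
      · exact hg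
      · exact V.neg_mem hg
    · have e : g = reluFam ![g, -g] 0 - reluFam ![g, -g] 1 := by
        ext x
        rcases le_total (g x) 0 with hx | hx <;> simp [reluFam, hx]
      rw [e]
      exact Submodule.sub_mem _ (subset_affHull _ ⟨0, by rw [← e]⟩)
        (subset_affHull _ ⟨1, by rw [← e]⟩)

theorem carry_range {ι : Type*} [Fintype ι] {g : ι → X → ℝ} (h1 : (1 : X → ℝ) ∈ V)
    (hg : ∀ i, g i ∈ V) :
    Reach (Fintype.card ι * 2) D V (⨆ i, affHull {g i}) :=
  par_iSup fun i => carry h1 (hg i)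

theorem pull (φ : Y → X) (h : Reach W D V U) :
    Reach W D (V.map (LinearMap.funLeft ℝ ℝ φ)) (U.map (LinearMap.funLeft ℝ ℝ φ)) := by
  induction D generalizing V with
  | zero => exact Submodule.map_mono h
  | succ D ih =>
    obtain ⟨f, hf, hr⟩ := h
    refine ⟨fun i => f i ∘ φ, fun i => ⟨f i, hf i, rfl⟩, (ih hr).mono_left ?_⟩
    rw [map_affHull, ← Set.range_comp]
    rfl

theorem lift (φ : Y → X) {T : Submodule ℝ (Y → ℝ)}
    (h : Reach W D (V.map (LinearMap.funLeft ℝ ℝ φ)) T) :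
    ∃ U, Reach W D V U ∧ T ≤ U.map (LinearMap.funLeft ℝ ℝ φ) := by
  induction D generalizing V with
  | zero => exact ⟨V, le_refl V, h⟩
  | succ D ih =>
    obtain ⟨f, hf, hr⟩ := h
    choose f' hf' hff' using hf
    obtain ⟨U, hU, hT⟩ := ih (V := affHull (Set.range (reluFam f'))) (by
      rw [map_affHull, ← Set.range_comp]
      have : f = fun i => f' i ∘ φ := by
        ext i x
        rw [← hff']
        rfl
      rw [this] at hr
      exact hr)
    exact ⟨U, ⟨f', hf', hU⟩, hT⟩

end Reach

theorem exists_coeff_of_mem_affHull {ι : Type*} [Fintype ι] {g : ι → X → ℝ} {f : X → ℝ}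
    (hf : f ∈ affHull (Set.range g)) :
    ∃ (a : ι → ℝ) (c : ℝ), ∀ x, f x = ∑ i, a i * g i x + c := by
  obtain ⟨c, z, hz, rfl⟩ := Submodule.mem_span_insert.1 hf
  obtain ⟨a, rfl⟩ := (Submodule.mem_span_range_iff_exists_fun ℝ).1 hz
  exact ⟨a, c, fun x => by simp [add_comm]⟩

/-- Prepending a ReLU layer to a network. -/
theorem IsReluNet.prepend {p q Wd D : ℕ} {g : (Fin q → ℝ) → ℝ} (hg : IsReluNet Wd D g)
    (hq : q ≤ Wd) (M : Matrix (Fin q) (Fin p) ℝ) (c : Fin q → ℝ) :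
    IsReluNet Wd (D + 1) (fun x : Fin p → ℝ => g (fun i => max ((M.mulVec x + c) i) 0)) := by
  obtain ⟨dims, rfl, hD, hW, A, b, hg⟩ := hg
  let dims' : ℕ → ℕ := fun l => Nat.casesOn l p dims
  let A' : ∀ l, Matrix (Fin (dims' (l + 1))) (Fin (dims' l)) ℝ := fun l => match l with
    | 0 => M
    | l + 1 => A l
  let b' : ∀ l, Fin (dims' (l + 1)) → ℝ := fun l => match l with
    | 0 => c
    | l + 1 => b l
  have key : ∀ (l : ℕ) (x : Fin p → ℝ),
      fwd dims' A' b' (l + 1) x = fwd dims A b l (fun i => max ((M.mulVec x + c) i) 0) := by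
    intro l x
    induction l with
    | zero => rfl
    | succ l ih => exact funext fun i => congrArg (fun y => max (((A l).mulVec y + b l) i) 0) ih
  refine ⟨dims', rfl, hD, ?_, A', b', fun x => ?_⟩
  · rintro (_ | _ | l) h1 h2
    · omega
    · exact hq
    · exact hW (l + 1) (by omega) (by omega)
  · exact (hg _).trans (congrArg (fun y => ((A D).mulVec y + b D) (Fin.cast hD.symm ⟨0, Nat.one_pos⟩))
      (key D x).symm)

theorem Reach.exists_isReluNet {W D p : ℕ} {V U : Submodule ℝ (X → ℝ)} (h : Reach W D V U)
    (φ : Fin p → X → ℝ) (hV : V ≤ affHull (Set.range φ)) {f : X → ℝ} (hf : f ∈ U) :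
    ∃ g : (Fin p → ℝ) → ℝ, IsReluNet W D g ∧ ∀ x, f x = g (fun i => φ i x) := by
  induction D generalizing V p with
  | zero =>
    obtain ⟨a, c, hac⟩ := exists_coeff_of_mem_affHull (hV (h hf))
    refine ⟨fun z => ∑ i, a i * z i + c, ?_, hac⟩
    refine ⟨fun l => Nat.casesOn l p fun _ => 1, rfl, rfl, fun l h1 h2 => by omega,
      fun l => match l with
        | 0 => fun _ i => a i
        | l + 1 => 0,
      fun l => match l with
        | 0 => fun _ => c
        | l + 1 => 0, fun x => rfl⟩
  | succ D ih =>
    obtain ⟨h, hh, hr⟩ := h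
    obtain ⟨g, hg, hfg⟩ := ih hr (reluFam h) le_rfl
    choose M c hM using fun i => exists_coeff_of_mem_affHull (hV (hh i))
    refine ⟨_, hg.prepend le_rfl (Matrix.of M) c, fun x => ?_⟩
    rw [hfg]
    congr 1
    ext i
    simp [reluFam, hM, Matrix.mulVec, dotProduct]

end Reach

section Components

variable {X : Type*}

theorem ramp_eq_indicator {δ r : ℝ} (hδ : 0 < δ) (hf : Int.fract r ≤ 1 - δ) (a : ℕ) :
    max ((r - a) / δ + 1) 0 - max ((r - a) / δ) 0 = if (a : ℝ) ≤ r then 1 else 0 := by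
  split_ifs with h
  · have : 0 ≤ (r - a) / δ := div_nonneg (by linarith) hδ.le
    rw [max_eq_left (by linarith), max_eq_left this]
    ring
  · have h1 : ⌊r⌋ < (a : ℤ) := Int.floor_lt.2 (by simpa using h)
    have h2 : (⌊r⌋ : ℝ) + 1 ≤ a := by exact_mod_cast h1
    have h3 := Int.floor_add_fract r
    have : (r - a) / δ ≤ -1 := by
      rw [div_le_iff₀ hδ]
      linarith
    rw [max_eq_right (by linarith), max_eq_right (by linarith)]
    ring

theorem sum_indicator_eq_floor {K P : ℕ} (hP : 0 < P) {r : ℝ} (h0 : 0 ≤ r) (hr : r < P * K) :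
    ∑ j : Fin K, (if (((j.1 + 1) * P : ℕ) : ℝ) ≤ r then (1 : ℝ) else 0) = ⌊r / P⌋₊ := by
  have hP' : (0 : ℝ) < P := by exact_mod_cast hP
  have hq : ⌊r / P⌋₊ < K := by
    rw [Nat.floor_lt (by positivity), div_lt_iff₀ hP']
    linarith
  have e : ∀ j : ℕ, (((j + 1) * P : ℕ) : ℝ) ≤ r ↔ j < ⌊r / P⌋₊ := by
    intro j
    rw [← Nat.succ_le_iff, Nat.le_floor_iff (by positivity), le_div_iff₀ hP']
    push_cast
    rfl
  simp_rw [e]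
  rw [Fin.sum_univ_eq_sum_range (fun j => if j < ⌊r / P⌋₊ then (1 : ℝ) else 0) K,
    Finset.sum_ite, Finset.sum_const_zero, add_zero, Finset.sum_const, nsmul_eq_mul, mul_one]
  congr 1
  have : {x ∈ Finset.range K | x < ⌊r / P⌋₊} = Finset.range ⌊r / P⌋₊ := by
    ext j
    simp only [Finset.mem_filter, Finset.mem_range]
    omega
  rw [this, Finset.card_range]

theorem hat_eq_indicator (a b : ℕ) :
    max ((a : ℝ) - b + 1) 0 - 2 * max ((a : ℝ) - b) 0 + max ((a : ℝ) - b - 1) 0 =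
      if a = b then 1 else 0 := by
  rcases lt_trichotomy a b with h | h | h
  · have : (a : ℝ) + 1 ≤ b := by exact_mod_cast h
    rw [if_neg h.ne, max_eq_right (by linarith), max_eq_right (by linarith),
      max_eq_right (by linarith)]
    ring
  · simp [h]
  · have : (b : ℝ) + 1 ≤ a := by exact_mod_cast h
    rw [if_neg h.ne', max_eq_left (by linarith), max_eq_left (by linarith),
      max_eq_left (by linarith)]
    ring

theorem step_eq_indicator (a b : ℕ) :
    max ((a : ℝ) - b + 1) 0 - max ((a : ℝ) - b) 0 = if b ≤ a then 1 else 0 := by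
  split_ifs with h
  · have : (b : ℝ) ≤ a := by exact_mod_cast h
    rw [max_eq_left (by linarith), max_eq_left (by linarith)]
    ring
  · have : (a : ℝ) + 1 ≤ b := by exact_mod_cast not_le.1 h
    rw [max_eq_right (by linarith), max_eq_right (by linarith)]
    ring

namespace Reach

variable {V : Submodule ℝ (X → ℝ)}

/-- A layer followed by an affine map, with membership in the target given explicitly. -/
theorem layer_of_mem {ι : Type*} [Fintype ι] {W : ℕ} (h : ι → X → ℝ)
    (hι : Fintype.card ι ≤ W) (hV : ∀ i, h i ∈ V) {S : Set (X → ℝ)}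
    (hS : ∀ f ∈ S, f ∈ affHull (Set.range (reluFam h))) : Reach W 1 V (affHull S) :=
  (layer h hι hV).mono_right (affHull_le (one_mem_affHull _) hS)

theorem fract {K : ℕ} (hK : 0 < K) {δ : ℝ} (hδ : 0 < δ) (m : ℕ) (h1 : (1 : X → ℝ) ∈ V)
    {ρ : X → ℝ} (hρ : ρ ∈ V) (h0 : ∀ x, 0 ≤ ρ x) (hlt : ∀ x, ρ x < (K : ℝ) ^ m)
    (hf : ∀ x, Int.fract (ρ x) ≤ 1 - δ) :
    Reach (2 * K + 2) m V (affHull {fun x => Int.fract (ρ x)}) := by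
  induction m generalizing V ρ with
  | zero =>
    refine affHull_le h1 ?_
    rw [Set.singleton_subset_iff, SetLike.mem_coe]
    convert hρ using 1
    ext x
    exact Int.fract_eq_self.2 ⟨h0 x, by simpa using hlt x⟩
  | succ m ih =>
    let ρ' : X → ℝ := fun x => ρ x - (K ^ m : ℕ) * ⌊ρ x / (K ^ m : ℕ)⌋₊
    have hP : 0 < K ^ m := by positivity
    have hP' : (0 : ℝ) < (K ^ m : ℕ) := by exact_mod_cast hP
    have hfr : ∀ x, Int.fract (ρ' x) = Int.fract (ρ x) := fun x => by
      have := Int.fract_sub_natCast (ρ x) (K ^ m * ⌊ρ x / (K ^ m : ℕ)⌋₊)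
      push_cast at this
      simpa [ρ'] using this
    have step : Reach (2 * K + 2) 1 V (affHull {ρ'}) := by
      let h : Option (Fin K × Bool) → X → ℝ := fun i => match i with
        | none => ρ
        | some (j, false) => fun x => (ρ x - ((j.1 + 1) * K ^ m : ℕ)) / δ + 1
        | some (j, true) => fun x => (ρ x - ((j.1 + 1) * K ^ m : ℕ)) / δ
      have haff : ∀ c : ℝ, (fun x => (ρ x - c) / δ) ∈ V := fun c => by
        have := V.smul_mem δ⁻¹ (V.sub_mem hρ (const_mem h1 c))
        convert this using 1
        ext x
        simp [div_eq_inv_mul]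
      refine layer_of_mem h (by simp; omega) ?_ ?_
      · rintro (_ | ⟨j, _ | _⟩)
        · exact hρ
        · exact V.add_mem (haff _) h1
        · exact haff _
      · rintro _ rfl
        have hm : ∀ i, reluFam h i ∈ affHull (Set.range (reluFam h)) :=
          fun i => subset_affHull _ ⟨i, rfl⟩
        have e : ρ' = reluFam h none - ((K ^ m : ℕ) : ℝ) •
            ∑ j : Fin K, (reluFam h (some (j, false)) - reluFam h (some (j, true))) := by
          ext x
          have hs := sum_indicator_eq_floor (K := K) hP (h0 x)
            (by push_cast; rw [← pow_succ]; exact hlt x)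
          simp only [reluFam, h, Pi.sub_apply, Pi.smul_apply, Finset.sum_apply, smul_eq_mul,
            ramp_eq_indicator hδ (hf x), hs, max_eq_left (h0 x), ρ']
        rw [e]
        exact Submodule.sub_mem _ (hm _) (Submodule.smul_mem _ _
          (Submodule.sum_mem _ fun j _ => Submodule.sub_mem _ (hm _) (hm _)))
    have := ih (one_mem_affHull _) (subset_affHull _ (Set.mem_singleton ρ')) (fun x => ?_)
      (fun x => ?_) (fun x => by rw [hfr]; exact hf x)
    · simp_rw [hfr] at this
      have := step.trans this
      rwa [add_comm 1 m] at this
    · have := Nat.floor_le (div_nonneg (h0 x) hP'.le)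
      rw [le_div_iff₀ hP'] at this
      simp only [ρ']
      linarith
    · have := Nat.lt_floor_add_one (ρ x / (K ^ m : ℕ))
      rw [div_lt_iff₀ hP'] at this
      simp only [ρ']
      push_cast at this ⊢
      linarith

theorem mod {K : ℕ} (hK : 0 < K) (h1 : (1 : X → ℝ) ∈ V) {j : X → ℕ}
    (hj : ∀ x, j x < K ^ 4) (hV : (fun x => (j x : ℝ)) ∈ V) {a : ℕ} (ha : 0 < a) :
    Reach (2 * K + 2) 4 V (affHull {fun x => ((j x % a : ℕ) : ℝ)}) := by
  have ha' : (0 : ℝ) < a := by exact_mod_cast ha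
  have hfr : ∀ x, Int.fract ((j x : ℝ) / a) = ((j x % a : ℕ) : ℝ) / a :=
    fun x => Int.fract_div_natCast_eq_div_natCast_mod
  have := fract (V := V) hK (δ := 1 / a) (by positivity) 4 h1
    (ρ := fun x => (j x : ℝ) / a) ?_ (fun x => by positivity) (fun x => ?_) (fun x => ?_)
  · refine this.mono_right (affHull_le (one_mem_affHull _) ?_)
    rw [Set.singleton_subset_iff, SetLike.mem_coe]
    convert Submodule.smul_mem _ (a : ℝ) (subset_affHull _ (Set.mem_singleton
      (fun x => Int.fract ((j x : ℝ) / a)))) using 1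
    ext x
    simp only [Pi.smul_apply, smul_eq_mul, hfr]
    field_simp
  · convert V.smul_mem (a : ℝ)⁻¹ hV using 1
    ext x
    simp [div_eq_inv_mul]
  · have h2 : (j x : ℝ) < (K : ℝ) ^ 4 := by exact_mod_cast hj x
    have h3 : (1 : ℝ) ≤ a := by exact_mod_cast ha
    exact (div_le_self (by positivity) h3).trans_lt h2
  · rw [hfr, div_le_iff₀ ha', sub_mul, one_mul, one_div, inv_mul_cancel₀ ha'.ne',
      le_sub_iff_add_le]
    exact_mod_cast Nat.mod_lt _ ha

theorem onehot (K : ℕ) (h1 : (1 : X → ℝ) ∈ V) {r : X → ℕ} (hr : (fun x => (r x : ℝ)) ∈ V) :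
    Reach (3 * K) 1 V
      (affHull (Set.range fun (k : Fin K) (x : X) => if r x = k then (1 : ℝ) else 0)) := by
  let h : Fin K × Fin 3 → X → ℝ := fun i x => (r x : ℝ) - (i.1 : ℕ) + ![1, 0, -1] i.2
  have hm : ∀ i, reluFam h i ∈ affHull (Set.range (reluFam h)) :=
    fun i => subset_affHull _ ⟨i, rfl⟩
  refine layer_of_mem h (by simp; omega)
    (fun i => V.add_mem (V.sub_mem hr (const_mem h1 _)) (const_mem h1 _)) ?_
  rintro _ ⟨k, rfl⟩
  have e : (fun x : X => if r x = k then (1 : ℝ) else 0) =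
      reluFam h (k, 0) - (2 : ℝ) • reluFam h (k, 1) + reluFam h (k, 2) := by
    ext x
    rw [← hat_eq_indicator (r x) k]
    simp [reluFam, h, sub_eq_add_neg]
  simp only [e]
  exact Submodule.add_mem _ (Submodule.sub_mem _ (hm _) (Submodule.smul_mem _ _ (hm _))) (hm _)

/-- Reading an entry of a `K × K × K` table of nonnegative numbers in `K` layers, given indicators
of the three coordinates. -/
theorem table {K : ℕ} (h1 : (1 : X → ℝ) ∈ V) {u t e : X → ℕ} (hu : ∀ x, u x < K)
    (ht : ∀ x, t x < K) (he : ∀ x, e x < K)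
    (hV : ∀ k : Fin K, (fun x => if u x = k then (1 : ℝ) else 0) ∈ V ∧
      (fun x => if t x = k then (1 : ℝ) else 0) ∈ V ∧
      (fun x => if e x = k then (1 : ℝ) else 0) ∈ V)
    (v : ℕ → ℕ → ℕ → ℝ) {C : ℝ} (hv0 : ∀ a b c, 0 ≤ v a b c)
    (hvC : ∀ a < K, ∀ b < K, ∀ c < K, v a b c ≤ C) :
    Reach (7 * K + 2) K V (affHull {fun x => v (u x) (t x) (e x)}) := by
  let oh : Fin 3 × Fin K → X → ℝ := fun i x => if ![u, t, e] i.1 x = i.2 then (1 : ℝ) else 0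
  let acc : ℕ → X → ℝ := fun m x => if u x < m then v (u x) (t x) (e x) else 0
  have acc_nonneg : ∀ m x, 0 ≤ acc m x := fun m x => by
    simp only [acc]
    split_ifs
    exacts [hv0 _ _ _, le_rfl]
  have hoh : ∀ i, oh i ∈ V := by
    rintro ⟨i, k⟩
    fin_cases i
    exacts [(hV k).1, (hV k).2.1, (hV k).2.2]
  have main : ∀ m ≤ K, Reach (7 * K + 2) m V ((⨆ i, affHull {oh i}) ⊔ affHull {acc m}) := by
    intro m
    induction m with
    | zero =>
      intro _
      refine sup_le (iSup_le fun i => affHull_le h1 (by simpa using hoh i)) (affHull_le h1 ?_)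
      rw [Set.singleton_subset_iff, SetLike.mem_coe]
      convert V.zero_mem using 1
      ext x
      simp [acc]
    | succ m ih =>
      intro hm
      refine (ih (by omega)).trans ?_
      set V' := (⨆ i, affHull {oh i}) ⊔ affHull {acc m} with hV'
      have h1' : (1 : X → ℝ) ∈ V' :=
        (le_sup_right : _ ≤ V') (one_mem_affHull _)
      have hacc : acc m ∈ V' := (le_sup_right : _ ≤ V') (subset_affHull _ rfl)
      have hoh' : ∀ i, oh i ∈ V' := fun i =>
        (le_sup_left : _ ≤ V') (le_iSup (fun i => affHull {oh i}) i (subset_affHull _ rfl))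
      let h : Option (Fin K) → X → ℝ := fun i => match i with
        | none => acc m
        | some e' => fun x => (∑ t' : Fin K, v m t' e' * oh (1, t') x) + C * oh (2, e') x
            + C * oh (0, ⟨m, by omega⟩) x + (-2 * C)
      have hval : ∀ (e' : Fin K) x, max (h (some e') x) 0 =
          if e x = e' ∧ u x = m then v m (t x) e' else 0 := by
        intro e' x
        have hs : (∑ t' : Fin K, v m t' e' * oh (1, t') x) = v m (t x) e' := by
          rw [Finset.sum_eq_single (⟨t x, ht x⟩ : Fin K)]
          · simp [oh]
          · intro b _ hb
            have : t x ≠ b := fun h => hb (Fin.ext h.symm)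
            simp [oh, this]
          · simp
        have b0 := hv0 m (t x) e'
        have b1 := hvC m (by omega) (t x) (ht x) e' e'.2
        simp only [h, hs]
        by_cases c1 : e x = e' <;> by_cases c2 : u x = m
        · have : v m (t x) e' + C + C + -(2 * C) = v m (t x) e' := by ring
          simp [oh, c1, c2, this, b0]
        · simp [oh, c1, c2]; linarith
        · simp [oh, c1, c2]; linarith
        · simp [oh, c1, c2]; linarith
      refine (par (W₁ := Fintype.card (Fin 3 × Fin K) * 2) (W₂ := K + 1)
        (carry_range h1' hoh') (layer_of_mem h (by simp) ?_ ?_)).mono_width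
          (by simp; omega)
      · rintro (_ | e')
        · exact hacc
        · refine V'.add_mem (V'.add_mem (V'.add_mem ?_ (V'.smul_mem C (hoh' (2, e'))))
            (V'.smul_mem C (hoh' (0, ⟨m, by omega⟩)))) (const_mem h1' _)
          convert V'.sum_mem (t := Finset.univ)
            fun (t' : Fin K) _ => V'.smul_mem (v m t' e') (hoh' (1, t')) using 1
          ext x
          simp
      · rintro _ rfl
        have hmem : ∀ i, reluFam h i ∈ affHull (Set.range (reluFam h)) :=
          fun i => subset_affHull _ ⟨i, rfl⟩
        have e : acc (m + 1) = reluFam h none + ∑ e' : Fin K, reluFam h (some e') := by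
          ext x
          simp only [reluFam, Pi.add_apply, Finset.sum_apply, hval]
          rw [Finset.sum_eq_single (⟨e x, he x⟩ : Fin K)]
          · have : max (h none x) 0 = acc m x := max_eq_left (acc_nonneg m x)
            rw [this]
            by_cases c : u x = m
            · simp [acc, c]
            · have : u x < m + 1 ↔ u x < m := by omega
              simp [acc, c, this]
          · intro b _ hb
            have : e x ≠ b := fun h => hb (Fin.ext h.symm)
            simp [this]
          · simp
        rw [e]
        exact Submodule.add_mem _ (hmem _) (Submodule.sum_mem _ fun _ _ => hmem _)
  refine (main K le_rfl).mono_right (le_trans (affHull_mono ?_) le_sup_right)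
  rw [Set.singleton_subset_iff, Set.mem_singleton_iff]
  ext x
  simp [acc, hu x]

/-- Extraction of the sum of the lowest `r` bits of a `K`-bit number in `2 K` layers. -/
theorem bits (K : ℕ) (h1 : (1 : X → ℝ) ∈ V) {θ r : X → ℕ} {acc : X → ℝ}
    (hθ : ∀ x, θ x < 2 ^ K) (hacc : ∀ x, 0 ≤ acc x)
    (hθV : (fun x => (θ x : ℝ)) ∈ V) (hrV : (fun x => (r x : ℝ)) ∈ V) (haccV : acc ∈ V) :
    Reach 7 (2 * K) V (affHull {fun x => acc x +
      ∑ k ∈ Finset.range K, if k < r x ∧ (θ x).testBit k then (1 : ℝ) else 0}) := by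
  induction K generalizing V θ acc with
  | zero =>
    refine affHull_le h1 ?_
    rw [Set.singleton_subset_iff, SetLike.mem_coe]
    simpa using haccV
  | succ K ih =>
    let b : X → ℝ := fun x => if 2 ^ K ≤ θ x then 1 else 0
    let c : X → ℝ := fun x => if K < r x then 1 else 0
    let rr : X → ℝ := fun x => r x
    let th : X → ℝ := fun x => θ x
    have first : Reach 7 1 V (affHull {b, c, rr, th, acc}) := by
      let h : Fin 7 → X → ℝ := ![rr, th, acc, fun x => (θ x : ℝ) - (2 ^ K : ℕ) + 1,
        fun x => (θ x : ℝ) - (2 ^ K : ℕ), fun x => (r x : ℝ) - (K + 1 : ℕ) + 1,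
        fun x => (r x : ℝ) - (K + 1 : ℕ)]
      have hm : ∀ i, reluFam h i ∈ affHull (Set.range (reluFam h)) :=
        fun i => subset_affHull _ ⟨i, rfl⟩
      refine layer_of_mem h (by simp) ?_ ?_
      · intro i
        fin_cases i
        · exact hrV
        · exact hθV
        · exact haccV
        · exact V.add_mem (V.sub_mem hθV (const_mem h1 _)) h1
        · exact V.sub_mem hθV (const_mem h1 _)
        · exact V.add_mem (V.sub_mem hrV (const_mem h1 _)) h1
        · exact V.sub_mem hrV (const_mem h1 _)
      · rintro _ (rfl | rfl | rfl | rfl | rfl)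
        · convert Submodule.sub_mem _ (hm 3) (hm 4) using 1
          ext x
          exact (step_eq_indicator _ _).symm
        · convert Submodule.sub_mem _ (hm 5) (hm 6) using 1
          ext x
          exact (step_eq_indicator _ _).symm
        · convert hm 0 using 1
          ext x
          simp [reluFam, h, rr]
        · convert hm 1 using 1
          ext x
          simp [reluFam, h, th]
        · convert hm 2 using 1
          ext x
          simp [reluFam, h, hacc x]
    let θ' : X → ℕ := fun x => θ x % 2 ^ K
    let acc' : X → ℝ := fun x => acc x + if K < r x ∧ (θ x).testBit K then (1 : ℝ) else 0
    have hb : ∀ x, (θ' x : ℝ) = θ x - 2 ^ K * b x ∧ ((θ x).testBit K ↔ 2 ^ K ≤ θ x) := by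
      intro x
      have hx := hθ x
      rw [pow_succ] at hx
      by_cases hle : 2 ^ K ≤ θ x
      · have : θ' x = θ x - 2 ^ K := by
          simp only [θ']
          rw [Nat.mod_eq_sub_mod hle, Nat.mod_eq_of_lt (by omega)]
        rw [this]
        refine ⟨by simp [b, hle], iff_of_true ?_ hle⟩
        rw [Nat.testBit_eq_decide_div_mod_eq]
        have : θ x / 2 ^ K = 1 := Nat.div_eq_of_lt_le (by omega) (by omega)
        simp [this]
      · have : θ' x = θ x := Nat.mod_eq_of_lt (by omega)
        rw [this]
        refine ⟨by simp [b, hle], iff_of_false ?_ hle⟩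
        rw [Nat.testBit_lt_two_pow (by omega)]
        simp
    have second : Reach 7 1 (affHull {b, c, rr, th, acc})
        (affHull {fun x => (θ' x : ℝ), rr, acc'}) := by
      set V' := affHull {b, c, rr, th, acc}
      have hs : ∀ f ∈ ({b, c, rr, th, acc} : Set (X → ℝ)), f ∈ V' := subset_affHull _
      let h : Fin 4 → X → ℝ := ![fun x => th x - 2 ^ K * b x, rr, acc, fun x => b x + c x - 1]
      have hm : ∀ i, reluFam h i ∈ affHull (Set.range (reluFam h)) :=
        fun i => subset_affHull _ ⟨i, rfl⟩
      refine layer_of_mem h (by simp) ?_ ?_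
      · intro i
        fin_cases i
        · exact V'.sub_mem (hs _ (by simp)) (V'.smul_mem (2 ^ K) (hs b (by simp)))
        · exact hs rr (by simp)
        · exact hs acc (by simp)
        · exact V'.sub_mem (V'.add_mem (hs b (by simp)) (hs c (by simp))) (one_mem_affHull _)
      · rintro _ (rfl | rfl | rfl)
        · convert hm 0 using 1
          ext x
          simp only [reluFam, h, th, Matrix.cons_val_zero, ← (hb x).1]
          exact (max_eq_left (by positivity)).symm
        · convert hm 1 using 1
          ext x
          simp [reluFam, h, rr]
        · convert Submodule.add_mem _ (hm 2) (hm 3) using 1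
          ext x
          have e1 : max (acc x) 0 = acc x := max_eq_left (hacc x)
          simp only [acc', reluFam, h, (hb x).2, Pi.add_apply, Matrix.cons_val, e1]
          by_cases c1 : 2 ^ K ≤ θ x <;> by_cases c2 : K < r x <;> simp [b, c, c1, c2]
    have hs : ∀ f ∈ ({fun x => (θ' x : ℝ), rr, acc'} : Set (X → ℝ)),
        f ∈ affHull {fun x => (θ' x : ℝ), rr, acc'} := subset_affHull _
    have third := ih (one_mem_affHull _) (θ := θ') (acc := acc')
      (fun x => Nat.mod_lt _ (by positivity))
      (fun x => add_nonneg (hacc x) (by split_ifs <;> simp))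
      (hs _ (by simp)) (hs _ (by simp [rr])) (hs _ (by simp))
    have := (first.trans second).trans third
    rw [show 1 + 1 + 2 * K = 2 * (K + 1) by ring] at this
    convert this using 4 with x
    rw [Finset.sum_range_succ, add_comm (Finset.sum _ _), ← add_assoc]
    congr 1
    refine Finset.sum_congr rfl fun k hk => ?_
    have : (θ' x).testBit k = (θ x).testBit k := by
      simp [θ', Nat.testBit_mod_two_pow, Finset.mem_range.1 hk]
    rw [this]

end Reach

end Components

section Approximation

variable {X : Type*}

theorem sum_increments {n : ℕ → ℕ} (hn : ∀ i, n (i + 1) = n i ∨ n (i + 1) = n i + 1)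
    {K r θ a : ℕ} (hr : r ≤ K)
    (hθ : ∀ k < K, θ.testBit k = decide (n (a + k + 1) = n (a + k) + 1)) :
    (n a : ℝ) + ∑ k ∈ Finset.range K, (if k < r ∧ θ.testBit k then (1 : ℝ) else 0) =
      n (a + r) := by
  have : ∑ k ∈ Finset.range K, (if k < r ∧ θ.testBit k then (1 : ℝ) else 0) =
      ∑ k ∈ Finset.range r, ((n (a + (k + 1)) : ℝ) - n (a + k)) := by
    rw [← Finset.sum_subset (Finset.range_mono hr) fun k _ hk =>
      if_neg fun h => hk (Finset.mem_range.2 h.1)]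
    refine Finset.sum_congr rfl fun k hk => ?_
    have hk := Finset.mem_range.1 hk
    rw [hθ k (by omega), ← add_assoc]
    rcases hn (a + k) with h | h <;> simp [hk, h]
  rw [this, Finset.sum_range_sub (fun k => (n (a + k) : ℝ))]
  simp

namespace Reach

variable {V : Submodule ℝ (X → ℝ)}

theorem staircase {K : ℕ} (hK : 0 < K) (h1 : (1 : X → ℝ) ∈ V) {j : X → ℕ}
    (hj : ∀ x, j x < K ^ 4) (hV : (fun x => (j x : ℝ)) ∈ V) {n : ℕ → ℕ}
    (hn : ∀ i, n (i + 1) = n i ∨ n (i + 1) = n i + 1) :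
    Reach (20 * K) (3 * K + 5) V (affHull {fun x => (n (j x) : ℝ)}) := by
  have mono : Monotone n := monotone_nat_of_le_succ fun i => by rcases hn i with h | h <;> omega
  have hK' : (K : ℝ) ≠ 0 := by exact_mod_cast hK.ne'
  let r : X → ℕ := fun x => j x % K
  let e : X → ℕ := fun x => j x / K % K
  let t : X → ℕ := fun x => j x / K ^ 2 % K
  let u : X → ℕ := fun x => j x / K ^ 3
  have he : ∀ x, e x < K := fun x => Nat.mod_lt _ hK
  have ht : ∀ x, t x < K := fun x => Nat.mod_lt _ hK
  have hu : ∀ x, u x < K := fun x => by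
    rw [Nat.div_lt_iff_lt_mul (by positivity), ← pow_succ']
    exact hj x
  have me : ∀ x, j x % K ^ 2 = j x % K + K * e x := fun x => by
    rw [pow_two, Nat.mod_mul]
  have mt : ∀ x, j x % K ^ 3 = j x % K ^ 2 + K ^ 2 * t x := fun x => by
    rw [pow_succ, Nat.mod_mul]
  have mu : ∀ x, j x = j x % K ^ 3 + K ^ 3 * u x := fun x => (Nat.mod_add_div _ _).symm
  have hq : ∀ x, j x = (u x * K ^ 2 + t x * K + e x) * K + r x := fun x => by
    have := mu x
    rw [mt, me] at this
    simp only [r]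
    linarith
  -- digits
  let V₁ := affHull {fun x => (j x : ℝ)} ⊔ (affHull {fun x => ((j x % K : ℕ) : ℝ)} ⊔
    (affHull {fun x => ((j x % K ^ 2 : ℕ) : ℝ)} ⊔ affHull {fun x => ((j x % K ^ 3 : ℕ) : ℝ)}))
  have s1 : Reach (20 * K) 4 V V₁ :=
    ((carry h1 hV).par ((mod hK h1 hj hV hK).par ((mod hK h1 hj hV (by positivity)).par
      (mod hK h1 hj hV (by positivity))))).mono_width (by omega)
  have one₁ : (1 : X → ℝ) ∈ V₁ := Submodule.mem_sup_left (one_mem_affHull _)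
  have j0 : (fun x => (j x : ℝ)) ∈ V₁ := Submodule.mem_sup_left (subset_affHull _ rfl)
  have j1 : (fun x => (r x : ℝ)) ∈ V₁ :=
    Submodule.mem_sup_right (Submodule.mem_sup_left (subset_affHull _ rfl))
  have j2 : (fun x => ((j x % K ^ 2 : ℕ) : ℝ)) ∈ V₁ := Submodule.mem_sup_right
    (Submodule.mem_sup_right (Submodule.mem_sup_left (subset_affHull _ rfl)))
  have j3 : (fun x => ((j x % K ^ 3 : ℕ) : ℝ)) ∈ V₁ := Submodule.mem_sup_right
    (Submodule.mem_sup_right (Submodule.mem_sup_right (subset_affHull _ rfl)))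
  have quot : ∀ {f g : X → ℝ} {k : X → ℕ} (c : ℝ), c ≠ 0 → f ∈ V₁ → g ∈ V₁ →
      (∀ x, f x = g x + c * k x) → (fun x => (k x : ℝ)) ∈ V₁ := by
    intro f g k c hc hf hg h
    convert V₁.smul_mem c⁻¹ (V₁.sub_mem hf hg) using 1
    ext x
    simp [h x, hc]
  have ee : (fun x => (e x : ℝ)) ∈ V₁ := quot K hK' j2 j1 fun x => by exact_mod_cast me x
  have te : (fun x => (t x : ℝ)) ∈ V₁ :=
    quot (K ^ 2) (by positivity) j3 j2 fun x => by exact_mod_cast mt x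
  have ue : (fun x => (u x : ℝ)) ∈ V₁ :=
    quot (K ^ 3) (by positivity) j0 j3 fun x => by exact_mod_cast mu x
  -- one-hot encodings
  let oh : (X → ℕ) → Submodule ℝ (X → ℝ) := fun k =>
    affHull (Set.range fun (i : Fin K) (x : X) => if k x = i then (1 : ℝ) else 0)
  let V₂ := affHull {fun x => (r x : ℝ)} ⊔ (oh u ⊔ (oh t ⊔ oh e))
  have s2 : Reach (20 * K) 1 V₁ V₂ :=
    ((carry one₁ j1).par ((onehot K one₁ ue).par ((onehot K one₁ te).par
      (onehot K one₁ ee)))).mono_width (by omega)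
  have one₂ : (1 : X → ℝ) ∈ V₂ := Submodule.mem_sup_left (one_mem_affHull _)
  have r₂ : (fun x => (r x : ℝ)) ∈ V₂ := Submodule.mem_sup_left (subset_affHull _ rfl)
  have ohV : ∀ k : Fin K, (fun x => if u x = k then (1 : ℝ) else 0) ∈ V₂ ∧
      (fun x => if t x = k then (1 : ℝ) else 0) ∈ V₂ ∧
      (fun x => if e x = k then (1 : ℝ) else 0) ∈ V₂ := fun k =>
    ⟨Submodule.mem_sup_right (Submodule.mem_sup_left (subset_affHull _ ⟨k, rfl⟩)),
      Submodule.mem_sup_right (Submodule.mem_sup_right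
        (Submodule.mem_sup_left (subset_affHull _ ⟨k, rfl⟩))),
      Submodule.mem_sup_right (Submodule.mem_sup_right
        (Submodule.mem_sup_right (subset_affHull _ ⟨k, rfl⟩)))⟩
  -- table lookups
  let Θ : ℕ → ℕ := fun a => Nat.ofBits fun k : Fin K => decide (n (a + k + 1) = n (a + k) + 1)
  have hΘ : ∀ a, Θ a < 2 ^ K := fun a => Nat.ofBits_lt_two_pow _
  let q : ℕ → ℕ → ℕ → ℕ := fun a b c => (a * K ^ 2 + b * K + c) * K
  have s3a := table one₂ hu ht he ohV (fun a b c => (n (q a b c) : ℝ)) (C := n (K ^ 4))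
    (fun a b c => by positivity) fun a ha b hb c hc => by
      refine Nat.cast_le.2 (mono ?_)
      have h1 : a * K ^ 2 + K ^ 2 ≤ K ^ 3 := by nlinarith [Nat.mul_le_mul_right (K ^ 2) ha]
      have h2 : b * K + K ≤ K ^ 2 := by nlinarith [Nat.mul_le_mul_right K hb]
      calc q a b c ≤ K ^ 3 * K := Nat.mul_le_mul_right _ (by omega)
        _ = K ^ 4 := by ring
  have s3b := table one₂ hu ht he ohV (fun a b c => (Θ (q a b c) : ℝ)) (C := 2 ^ K)
    (fun a b c => by positivity) fun a ha b hb c hc => by exact_mod_cast (hΘ _).le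
  let V₃ := affHull {fun x => (r x : ℝ)} ⊔ (affHull {fun x => (n (q (u x) (t x) (e x)) : ℝ)} ⊔
    affHull {fun x => (Θ (q (u x) (t x) (e x)) : ℝ)})
  have s3 : Reach (20 * K) K V₂ V₃ :=
    ((carry one₂ r₂).par (s3a.par s3b)).mono_width (by omega)
  -- bit extraction
  have s4 := bits (V := V₃) K (Submodule.mem_sup_left (one_mem_affHull _))
    (θ := fun x => Θ (q (u x) (t x) (e x))) (r := r)
    (acc := fun x => (n (q (u x) (t x) (e x)) : ℝ)) (fun x => hΘ _) (fun x => by positivity)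
    (Submodule.mem_sup_right (Submodule.mem_sup_right (subset_affHull _ rfl)))
    (Submodule.mem_sup_left (subset_affHull _ rfl))
    (Submodule.mem_sup_right (Submodule.mem_sup_left (subset_affHull _ rfl)))
  have := ((s1.trans s2).trans s3).trans (s4.mono_width (by omega))
  rw [show 4 + 1 + K + 2 * K = 3 * K + 5 by ring] at this
  convert this using 4 with x
  rw [sum_increments hn (Nat.mod_lt _ hK).le fun k hk => ?_]
  · exact congrArg (fun i => (n i : ℝ)) (hq x)
  · exact Nat.testBit_ofBits_lt _ _ hk

theorem lipschitz {K : ℕ} (hK : 0 < K) (h1 : (1 : X → ℝ) ∈ V) {j : X → ℕ}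
    (hj : ∀ x, j x < K ^ 4) (hV : (fun x => (j x : ℝ)) ∈ V) {f : ℝ → ℝ} {ε : ℝ} (hε : 0 < ε)
    (hf : ∀ a b, |f a - f b| ≤ ε * |a - b|) :
    ∃ F : X → ℝ, Reach (22 * K) (3 * K + 5) V (affHull {F}) ∧
      ∀ x, |F x - f (j x)| ≤ 2 * ε := by
  let z : ℕ → ℝ := fun i => (f i - f 0 + ε * i) / (2 * ε)
  have hz0 : ∀ i, 0 ≤ z i := fun i => by
    have := hf i 0
    rw [sub_zero, Nat.abs_cast] at this
    exact div_nonneg (by linarith [(abs_le.1 this).1]) (by positivity)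
  have hz1 : ∀ i, z i ≤ z (i + 1) ∧ z (i + 1) ≤ z i + 1 := fun i => by
    have := hf (i + 1 : ℕ) i
    rw [show |((i + 1 : ℕ) : ℝ) - i| = 1 by simp, mul_one] at this
    obtain ⟨h1, h2⟩ := abs_le.1 this
    simp only [z]
    push_cast at *
    constructor
    · gcongr ?_ / _
      linarith
    · rw [div_add_one (by positivity)]
      gcongr ?_ / _
      linarith
  let n : ℕ → ℕ := fun i => ⌊z i⌋₊
  have hn : ∀ i, n (i + 1) = n i ∨ n (i + 1) = n i + 1 := fun i => by
    have h2 : n i ≤ n (i + 1) := Nat.floor_mono (hz1 i).1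
    have h3 : n (i + 1) ≤ n i + 1 := by
      rw [← Nat.floor_add_one (hz0 i)]
      exact Nat.floor_mono (hz1 i).2
    omega
  have h22 := ((staircase hK h1 hj hV hn).par (carry h1 hV)).mono_width
    (W' := 22 * K) (by omega)
  refine ⟨fun x => 2 * ε * n (j x) - ε * j x + f 0, h22.mono_right
    (affHull_le (Submodule.mem_sup_left (one_mem_affHull _)) ?_), fun x => ?_⟩
  · rw [Set.singleton_subset_iff, SetLike.mem_coe]
    exact Submodule.add_mem _ (Submodule.sub_mem _
      (Submodule.smul_mem _ (2 * ε) (Submodule.mem_sup_left (subset_affHull _ rfl)))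
      (Submodule.smul_mem _ ε (Submodule.mem_sup_right (subset_affHull _ rfl))))
      (const_mem (Submodule.mem_sup_left (one_mem_affHull _)) _)
  · have h2 := Nat.floor_le (hz0 (j x))
    have h3 := Nat.lt_floor_add_one (z (j x))
    rw [le_div_iff₀ (by positivity)] at h2
    rw [div_lt_iff₀ (by positivity)] at h3
    simp only [n, z] at *
    rw [abs_le]
    constructor <;> nlinarith

end Reach

theorem index_separation {s N : ℕ} {b b' : Fin (s + 1) → ℕ} (hb : ∀ i, 2 * b i < N)
    (hb' : ∀ i, 2 * b' i < N) (hne : b ≠ b') :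
    1 ≤ |((∑ i, b i * N ^ i.1 : ℕ) : ℤ) - (∑ i, b' i * N ^ i.1 : ℕ)| ∧
    ∀ i, |(b i : ℤ) - b' i| ≤ |((∑ i, b i * N ^ i.1 : ℕ) : ℤ) - (∑ i, b' i * N ^ i.1 : ℕ)| := by
  have inj : ∀ {k : ℕ} (c c' : Fin k → ℕ), (∀ i, c i < N) → (∀ i, c' i < N) →
      ∑ i, c i * N ^ i.1 = ∑ i, c' i * N ^ i.1 → c = c' := by
    intro k c c' hc hc' h
    have : (fun i => (⟨c i, hc i⟩ : Fin N)) = fun i => ⟨c' i, hc' i⟩ :=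
      finFunctionFinEquiv.injective (Fin.ext (by simpa [finFunctionFinEquiv_apply] using h))
    ext i
    exact congrArg Fin.val (congrFun this i)
  have split : ∀ c : Fin (s + 1) → ℕ, ∑ i, c i * N ^ i.1 =
      c 0 + N * ∑ i : Fin s, c i.succ * N ^ i.1 := by
    intro c
    rw [Fin.sum_univ_succ, Finset.mul_sum]
    simp only [Fin.val_zero, pow_zero, mul_one, Fin.val_succ, pow_succ]
    congr 1
    exact Finset.sum_congr rfl fun i _ => by ring
  refine ⟨Int.one_le_abs (sub_ne_zero.2 fun h => hne (inj b b' (fun i => by linarith [hb i])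
    (fun i => by linarith [hb' i]) (by exact_mod_cast h))), fun i => ?_⟩
  rw [split b, split b']
  set q := ∑ i : Fin s, b i.succ * N ^ i.1 with hq
  set q' := ∑ i : Fin s, b' i.succ * N ^ i.1 with hq'
  have h0 := hb 0
  have h0' := hb' 0
  rcases lt_trichotomy q q' with h | h | h
  · have : (N : ℤ) * q + N ≤ N * q' := by exact_mod_cast Nat.mul_le_mul_left N h
    have h2 := hb i
    have h2' := hb' i
    push_cast
    rw [abs_of_nonpos (a := (b 0 : ℤ) + _ - _) (by omega), abs_le]
    constructor <;> omega
  · have tail := inj _ _ (fun i => by linarith [hb i.succ]) (fun i => by linarith [hb' i.succ]) h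
    rw [h]
    refine Fin.cases ?_ (fun i => ?_) i
    · simp
    · simp [congrFun tail i]
  · have : (N : ℤ) * q' + N ≤ N * q := by exact_mod_cast Nat.mul_le_mul_left N h
    have h2 := hb i
    have h2' := hb' i
    push_cast
    rw [abs_of_nonneg (a := (b 0 : ℤ) + _ - _) (by omega), abs_le]
    constructor <;> omega

theorem exists_lipschitz_of_index {s N : ℕ} (hs : 1 ≤ s) {H : (Fin s → ℝ) → ℝ} {ε : ℝ}
    (hε : 0 < ε)
    (hH : ∀ ξ ξ' D, 1 ≤ D → (∀ i, |ξ i - ξ' i| ≤ D) → |H ξ - H ξ'| ≤ ε * D) :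
    ∃ f : ℝ → ℝ, (∀ a b, |f a - f b| ≤ ε * |a - b|) ∧
      ∀ b : Fin s → ℕ, (∀ i, 2 * b i < N) →
        f (∑ i, b i * N ^ i.1 : ℕ) = H fun i => b i := by
  obtain ⟨s, rfl⟩ : ∃ k, s = k + 1 := ⟨s - 1, by omega⟩
  have key : ∀ b b' : Fin (s + 1) → ℕ, (∀ i, 2 * b i < N) → (∀ i, 2 * b' i < N) →
      |H (fun i => b i) - H (fun i => b' i)| ≤
        ε * |((∑ i, b i * N ^ i.1 : ℕ) : ℝ) - (∑ i, b' i * N ^ i.1 : ℕ)| := by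
    intro b b' hb hb'
    by_cases hne : b = b'
    · simp [hne]
    · obtain ⟨h1, h2⟩ := index_separation hb hb' hne
      refine hH _ _ _ ?_ fun i => ?_
      · exact_mod_cast h1
      · exact_mod_cast h2 i
  classical
  let f₀ : ℝ → ℝ := fun t =>
    if h : ∃ b : Fin (s + 1) → ℕ, (∀ i, 2 * b i < N) ∧ ((∑ i, b i * N ^ i.1 : ℕ) : ℝ) = t then
      H fun i => h.choose i else 0
  have hlip : LipschitzOnWith ε.toNNReal f₀ {t | ∃ b : Fin (s + 1) → ℕ,
      (∀ i, 2 * b i < N) ∧ ((∑ i, b i * N ^ i.1 : ℕ) : ℝ) = t} := by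
    refine LipschitzOnWith.of_dist_le_mul fun t ht t' ht' => ?_
    have h := key _ _ ht.choose_spec.1 ht'.choose_spec.1
    rw [ht.choose_spec.2, ht'.choose_spec.2] at h
    simp only [Set.mem_ofPred_eq] at ht ht'
    rw [Real.coe_toNNReal _ hε.le, Real.dist_eq, Real.dist_eq]
    simp only [f₀, dif_pos ht, dif_pos ht']
    exact h
  obtain ⟨f, hf, hfe⟩ := hlip.extend_real
  refine ⟨f, fun a b => ?_, fun b hb => ?_⟩
  · have := hf.dist_le_mul a b
    rwa [Real.coe_toNNReal _ hε.le, Real.dist_eq, Real.dist_eq] at this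
  · have hex : ∃ b' : Fin (s + 1) → ℕ, (∀ i, 2 * b' i < N) ∧
        ((∑ i, b' i * N ^ i.1 : ℕ) : ℝ) = (∑ i, b i * N ^ i.1 : ℕ) := ⟨b, hb, rfl⟩
    rw [← hfe hex]
    simp only [f₀, dif_pos hex]
    have h := key _ _ hex.choose_spec.1 hb
    rw [hex.choose_spec.2, sub_self, abs_zero, mul_zero] at h
    exact sub_eq_zero.1 (abs_nonpos_iff.1 h)

/-- The affine functions on `ℝ^s`. -/
def affineFunctions (s : ℕ) : Submodule ℝ ((Fin s → ℝ) → ℝ) :=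
  affHull (Set.range fun i ξ => ξ i)

open Submodule in
/-- Approximation away from a neighbourhood of the grid hyperplanes. -/
theorem exists_reach_off_grid {s B : ℕ} (hs : 1 ≤ s) (hB : 0 < B) {H : (Fin s → ℝ) → ℝ} {ε : ℝ}
    (hε : 0 < ε)
    (hH : ∀ ξ ξ' D, 1 ≤ D → (∀ i, |ξ i - ξ' i| ≤ D) → |H ξ - H ξ'| ≤ ε * D) :
    ∃ g : (Fin s → ℝ) → ℝ,
      Reach (22 * (s * B ^ s)) (3 * B ^ s + 9) (affineFunctions s) (span ℝ {g}) ∧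
      ∀ ξ, (∀ i, 0 ≤ ξ i ∧ 2 * ξ i < ((B ^ 4 : ℕ) : ℝ) ∧ Int.fract (ξ i) ≤ 3 / 4) →
        |g ξ - H ξ| ≤ 3 * ε := by
  set K := B ^ s with hKdef
  set N := B ^ 4 with hN
  have hK : 0 < K := by positivity
  have hNK : N ≤ K ^ 4 := by
    rw [hN, hKdef, ← pow_mul]
    exact Nat.pow_le_pow_right hB (by omega)
  have hsK : K ≤ s * K := Nat.le_mul_of_pos_left _ hs
  have hss : s ≤ s * K := Nat.le_mul_of_pos_right _ hK
  obtain ⟨f, hf, hfH⟩ := exists_lipschitz_of_index (N := N) hs hε hH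
  let P : (Fin s → ℝ) → Prop := fun ξ =>
    ∀ i, 0 ≤ ξ i ∧ 2 * ξ i < N ∧ Int.fract (ξ i) ≤ 3 / 4
  let φ : {ξ // P ξ} → Fin s → ℝ := Subtype.val
  set V := (affineFunctions s).map (LinearMap.funLeft ℝ ℝ φ) with hV
  have one : (1 : {ξ // P ξ} → ℝ) ∈ V := ⟨1, one_mem_affHull _, rfl⟩
  have coord : ∀ i, (fun y => φ y i) ∈ V := fun i =>
    ⟨fun ξ => ξ i, subset_affHull _ ⟨i, rfl⟩, rfl⟩
  let V₁ := (⨆ i, affHull {fun y => φ y i}) ⊔ ⨆ i, affHull {fun y => Int.fract (φ y i)}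
  have s1 : Reach (22 * (s * K)) 4 V V₁ := by
    refine ((Reach.carry_range one coord).par (Reach.par_iSup fun i =>
      Reach.fract hK (δ := 1 / 4) (by norm_num) 4 one (coord i) (fun y => (y.2 i).1)
        (fun y => ?_) fun y => ?_)).mono_width ?_
    · have h1 := (y.2 i).1
      have h2 := (y.2 i).2.1
      have h3 : (N : ℝ) ≤ (K : ℝ) ^ 4 := by exact_mod_cast hNK
      simp only [φ]
      linarith
    · exact (y.2 i).2.2.trans (by norm_num)
    · simp only [Fintype.card_fin]
      nlinarith
  let c : {ξ // P ξ} → Fin s → ℕ := fun y i => ⌊φ y i⌋₊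
  have hc : ∀ y i, (c y i : ℝ) = φ y i - Int.fract (φ y i) := fun y i => by
    rw [Int.self_sub_fract]
    exact natCast_floor_eq_intCast_floor (y.2 i).1
  have hcN : ∀ y i, 2 * c y i < N := fun y i => by
    have h1 : (c y i : ℝ) ≤ φ y i := Nat.floor_le (y.2 i).1
    have h2 : 2 * φ y i < N := (y.2 i).2.1
    have h3 : (2 * c y i : ℝ) < N := by linarith
    exact_mod_cast h3
  let j : {ξ // P ξ} → ℕ := fun y => ∑ i, c y i * N ^ i.1
  have hjK : ∀ y, j y < K ^ 4 := fun y => by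
    have h := (finFunctionFinEquiv fun i => (⟨c y i, by have := hcN y i; omega⟩ : Fin N)).2
    rw [finFunctionFinEquiv_apply] at h
    calc j y < N ^ s := h
      _ = K ^ 4 := by rw [hN, hKdef, ← pow_mul, ← pow_mul, mul_comm]
  have one₁ : (1 : {ξ // P ξ} → ℝ) ∈ V₁ :=
    (le_sup_left : _ ≤ V₁) (le_iSup (fun i => affHull {fun y => φ y i}) ⟨0, hs⟩
      (one_mem_affHull _))
  have hj : (fun y => (j y : ℝ)) ∈ V₁ := by
    have e : (fun y => (j y : ℝ)) =
        ∑ i, (N ^ i.1 : ℝ) • ((fun y => φ y i) - fun y => Int.fract (φ y i)) := by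
      ext y
      simp only [j, Nat.cast_sum, Nat.cast_mul, Nat.cast_pow, hc, Finset.sum_apply,
        Pi.smul_apply, Pi.sub_apply, smul_eq_mul]
      exact Finset.sum_congr rfl fun i _ => mul_comm _ _
    rw [e]
    refine sum_mem fun i _ => smul_mem _ _ (Submodule.sub_mem _ ?_ ?_)
    · exact (le_sup_left : _ ≤ V₁) (le_iSup (fun i => affHull {fun y => φ y i}) i
        (subset_affHull _ rfl))
    · exact (le_sup_right : _ ≤ V₁) (le_iSup (fun i => affHull {fun y => Int.fract (φ y i)}) i
        (subset_affHull _ rfl))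
  obtain ⟨F, hF, hFf⟩ := Reach.lipschitz hK one₁ hjK hj hε hf
  have hr := s1.trans (hF.mono_width (Nat.mul_le_mul_left 22 hsK))
  obtain ⟨U, hU, hT⟩ := hr.lift φ
  obtain ⟨g, hg, hgF⟩ := hT (subset_affHull _ rfl)
  refine ⟨g, ?_, fun ξ hξ => ?_⟩
  · rw [show 3 * K + 9 = 4 + (3 * K + 5) by ring]
    exact hU.mono_right (by simpa [span_le] using hg)
  · have h1 := hFf ⟨ξ, hξ⟩
    have h2 : f (j ⟨ξ, hξ⟩) = H fun i => c ⟨ξ, hξ⟩ i := hfH _ (hcN _)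
    have h3 := hH (fun i => c ⟨ξ, hξ⟩ i) ξ 1 le_rfl fun i => by
      rw [hc, abs_le]
      have h4 := Int.fract_nonneg (ξ i)
      have h5 := (Int.fract_lt_one (ξ i)).le
      simp only [φ]
      constructor <;> linarith
    have h6 : F ⟨ξ, hξ⟩ = g ξ := (congrFun hgF ⟨ξ, hξ⟩).symm
    rw [h2, h6] at h1
    calc |g ξ - H ξ| ≤ _ + _ := abs_sub_le _ (H fun i => c ⟨ξ, hξ⟩ i) _
      _ ≤ 3 * ε := by linarith

end Approximation

section Median

/-- The median of three real numbers. -/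
def med3 (a b c : ℝ) : ℝ := max (min a b) (min (max a b) c)

theorem med3_eq (a b c : ℝ) :
    med3 a b c = (a - max (a - b) 0) + max (c - (a - max (a - b) 0)) 0 -
      max (c - (b + max (a - b) 0)) 0 := by
  unfold med3
  grind

theorem abs_med3_sub_le {a b c x E : ℝ}
    (h : (|a - x| ≤ E ∧ |b - x| ≤ E) ∨ (|a - x| ≤ E ∧ |c - x| ≤ E) ∨
      (|b - x| ≤ E ∧ |c - x| ≤ E)) : |med3 a b c - x| ≤ E := by
  simp only [abs_le] at *
  unfold med3
  grind

theorem mem_affHull_reluFam {X ι : Type*} {h : ι → X → ℝ} {f : X → ℝ} (i j : ι) (hi : h i = f)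
    (hj : h j = -f) : f ∈ affHull (Set.range (reluFam h)) := by
  have e : f = reluFam h i - reluFam h j := by
    ext x
    rcases le_total (f x) 0 with hx | hx <;> simp [reluFam, hi, hj, hx]
  rw [e]
  exact Submodule.sub_mem _ (subset_affHull _ ⟨i, rfl⟩) (subset_affHull _ ⟨j, rfl⟩)

theorem Reach.med3 {X : Type*} {W D : ℕ} {V : Submodule ℝ (X → ℝ)} {a b c : X → ℝ}
    (hW : 7 ≤ 3 * W) (ha : Reach W D V (Submodule.span ℝ {a}))
    (hb : Reach W D V (Submodule.span ℝ {b})) (hc : Reach W D V (Submodule.span ℝ {c})) :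
    Reach (3 * W) (D + 2) V (Submodule.span ℝ {fun x => _root_.med3 (a x) (b x) (c x)}) := by
  have h0 := ((ha.par hb).par hc).mono_width (W' := 3 * W) (by omega)
  set U := Submodule.span ℝ {a} ⊔ Submodule.span ℝ {b} ⊔ Submodule.span ℝ {c}
  have ma : a ∈ U := (le_sup_left.trans le_sup_left : _ ≤ U) (Submodule.subset_span rfl)
  have mb : b ∈ U := (le_sup_right.trans le_sup_left : _ ≤ U) (Submodule.subset_span rfl)
  have mc : c ∈ U := (le_sup_right : _ ≤ U) (Submodule.subset_span rfl)
  let r : X → ℝ := fun x => max (a x - b x) 0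
  have h1 : Reach (3 * W) 1 U (affHull {r, a, b, c}) := by
    refine Reach.layer_of_mem ![a - b, a, -a, b, -b, c, -c] (by simpa using hW) (fun i => ?_) ?_
    · fin_cases i
      exacts [U.sub_mem ma mb, ma, U.neg_mem ma, mb, U.neg_mem mb, mc, U.neg_mem mc]
    · rintro _ (rfl | rfl | rfl | rfl)
      · exact subset_affHull _ ⟨0, rfl⟩
      · exact mem_affHull_reluFam 1 2 rfl rfl
      · exact mem_affHull_reluFam 3 4 rfl rfl
      · exact mem_affHull_reluFam 5 6 rfl rfl
  set U₁ := affHull {r, a, b, c}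
  have nr : r ∈ U₁ := subset_affHull _ (by simp)
  have na : a ∈ U₁ := subset_affHull _ (by simp)
  have nb : b ∈ U₁ := subset_affHull _ (by simp)
  have nc : c ∈ U₁ := subset_affHull _ (by simp)
  have h2 : Reach (3 * W) 1 U₁ (affHull {fun x => _root_.med3 (a x) (b x) (c x)}) := by
    refine Reach.layer_of_mem ![a - r, -(a - r), c - (a - r), c - (b + r)]
      (by simp; omega) (fun i => ?_) ?_
    · fin_cases i
      exacts [U₁.sub_mem na nr, U₁.neg_mem (U₁.sub_mem na nr), U₁.sub_mem nc (U₁.sub_mem na nr),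
        U₁.sub_mem nc (U₁.add_mem nb nr)]
    · intro f hf
      rw [Set.mem_singleton_iff] at hf
      have e : (fun x => _root_.med3 (a x) (b x) (c x)) =
          (a - r) + reluFam ![a - r, -(a - r), c - (a - r), c - (b + r)] 2 -
            reluFam ![a - r, -(a - r), c - (a - r), c - (b + r)] 3 := by
        ext x
        exact med3_eq _ _ _
      rw [hf, e]
      exact Submodule.sub_mem _ (Submodule.add_mem _ (mem_affHull_reluFam 0 1 rfl rfl)
        (subset_affHull _ ⟨2, rfl⟩)) (subset_affHull _ ⟨3, rfl⟩)
  exact ((h0.trans h1).trans h2).mono_right (Submodule.span_le.2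
    (Set.singleton_subset_iff.2 (subset_affHull _ (Set.mem_singleton _))))

theorem affineFunctions_map_add (s : ℕ) (v : Fin s → ℝ) :
    (affineFunctions s).map (LinearMap.funLeft ℝ ℝ fun ξ => ξ + v) ≤ affineFunctions s := by
  rw [affineFunctions, map_affHull]
  refine affHull_le (one_mem_affHull _) ?_
  rintro _ ⟨_, ⟨i, rfl⟩, rfl⟩
  exact Submodule.add_mem _ (subset_affHull _ ⟨i, rfl⟩) (const_mem (one_mem_affHull _) (v i))

theorem Reach.shift {s W D : ℕ} {g : (Fin s → ℝ) → ℝ}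
    (h : Reach W D (affineFunctions s) (Submodule.span ℝ {g})) (v : Fin s → ℝ) :
    Reach W D (affineFunctions s) (Submodule.span ℝ {fun ξ => g (ξ + v)}) := by
  have := (h.pull fun ξ => ξ + v).mono_left (affineFunctions_map_add s v)
  rw [Submodule.map_span, Set.image_singleton] at this
  exact this

theorem fract_quarter_shift (t : ℝ) :
    (Int.fract (t - 1 / 4) ≤ 3 / 4 ∧ Int.fract t ≤ 3 / 4) ∨
    (Int.fract (t - 1 / 4) ≤ 3 / 4 ∧ Int.fract (t + 1 / 4) ≤ 3 / 4) ∨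
    (Int.fract t ≤ 3 / 4 ∧ Int.fract (t + 1 / 4) ≤ 3 / 4) := by
  have h0 := Int.fract_nonneg t
  have h1 := Int.fract_lt_one t
  have e := Int.self_sub_floor t
  have key : ∀ (u : ℝ) (z : ℤ), 0 ≤ u - z → u - z < 1 → Int.fract u = u - z := fun u z h h' =>
    Int.fract_eq_iff.2 ⟨h, h', z, by ring⟩
  rcases le_or_gt (Int.fract t) (3 / 4) with h | h
  · rcases le_or_gt (Int.fract t) (1 / 2) with h' | h'
    · refine Or.inr (Or.inr ⟨h, ?_⟩)
      rw [key _ ⌊t⌋ (by linarith) (by linarith)]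
      linarith
    · refine Or.inl ⟨?_, h⟩
      rw [key _ ⌊t⌋ (by linarith) (by linarith)]
      linarith
  · refine Or.inr (Or.inl ⟨?_, ?_⟩)
    · rw [key _ ⌊t⌋ (by linarith) (by linarith)]
      linarith
    · rw [key _ (⌊t⌋ + 1) (by push_cast; linarith) (by push_cast; linarith)]
      push_cast
      linarith

theorem exists_reach_of_grid {s N W D : ℕ} {H : (Fin s → ℝ) → ℝ} {ε : ℝ} (hW : 7 ≤ 3 * W)
    (hH : ∀ ξ ξ' D, 1 ≤ D → (∀ i, |ξ i - ξ' i| ≤ D) → |H ξ - H ξ'| ≤ ε * D)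
    {g : (Fin s → ℝ) → ℝ} (hg : Reach W D (affineFunctions s) (Submodule.span ℝ {g}))
    (hgH : ∀ ξ, (∀ i, 0 ≤ ξ i ∧ 2 * ξ i < (N : ℝ) ∧ Int.fract (ξ i) ≤ 3 / 4) →
      |g ξ - H ξ| ≤ 3 * ε) (k : ℕ) (hk : k ≤ s) :
    ∃ g : (Fin s → ℝ) → ℝ,
      Reach (3 ^ k * W) (D + 2 * k) (affineFunctions s) (Submodule.span ℝ {g}) ∧
      ∀ ξ, (∀ i, i.1 < k → 1 ≤ ξ i ∧ 2 * (ξ i + 1) ≤ (N : ℝ)) →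
        (∀ i, k ≤ i.1 → 0 ≤ ξ i ∧ 2 * ξ i < (N : ℝ) ∧ Int.fract (ξ i) ≤ 3 / 4) →
        |g ξ - H ξ| ≤ (3 + k) * ε := by
  induction k with
  | zero => exact ⟨g, by simpa using hg, fun ξ _ h => by simpa using hgH ξ fun i => h i (by simp)⟩
  | succ k ih =>
    obtain ⟨g', hr, hg'⟩ := ih (by omega)
    let κ : Fin s := ⟨k, hk⟩
    refine ⟨fun ξ => med3 (g' (ξ + Pi.single κ (-1 / 4))) (g' ξ) (g' (ξ + Pi.single κ (1 / 4))),
      ?_, fun ξ h1 h2 => ?_⟩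
    · have h3 : 1 ≤ 3 ^ k := Nat.one_le_pow _ _ (by norm_num)
      rw [pow_succ', mul_assoc]
      exact Reach.med3 (by nlinarith) (hr.shift _) hr (hr.shift _)
    · have key : ∀ δ : ℝ, |δ| ≤ 1 / 4 → Int.fract (ξ κ + δ) ≤ 3 / 4 →
          |g' (ξ + Pi.single κ δ) - H ξ| ≤ (3 + (k + 1 : ℕ)) * ε := by
        intro δ hδ hfr
        have hδ' := abs_le.1 hδ
        have hs : ∀ i, i ≠ κ → (ξ + Pi.single κ δ : Fin s → ℝ) i = ξ i := fun i hi => by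
          simp [hi]
        have hκ : (ξ + Pi.single κ δ : Fin s → ℝ) κ = ξ κ + δ := by simp
        have h4 := hg' (ξ + Pi.single κ δ) (fun i hi => by
            rw [hs i (by rintro rfl; simp [κ] at hi)]
            exact h1 i (by omega)) fun i hi => by
          rcases eq_or_ne i κ with rfl | hne
          · have := h1 κ (by simp [κ])
            rw [hκ]
            exact ⟨by linarith, by linarith, hfr⟩
          · rw [hs i hne]
            exact h2 i (by
              have : i.1 ≠ k := fun h => hne (Fin.ext h)
              omega)
        have h5 := hH (ξ + Pi.single κ δ) ξ 1 le_rfl fun i => by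
          rcases eq_or_ne i κ with rfl | hne
          · rw [hκ, add_sub_cancel_left]
            linarith
          · rw [hs i hne]
            simp
        calc _ ≤ _ + _ := abs_sub_le _ (H (ξ + Pi.single κ δ)) _
          _ ≤ _ := by push_cast; linarith
      have key0 : Int.fract (ξ κ) ≤ 3 / 4 → |g' ξ - H ξ| ≤ (3 + (k + 1 : ℕ)) * ε := fun h => by
        simpa using key 0 (by norm_num) (by simpa using h)
      have kp := key (1 / 4) (by norm_num [abs_le])
      have km := key (-1 / 4) (by norm_num [abs_le])
      rw [neg_div, ← sub_eq_add_neg, ← neg_div] at km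
      refine abs_med3_sub_le ?_
      rcases fract_quarter_shift (ξ κ) with h | h | h
      · exact Or.inl ⟨km h.1, key0 h.2⟩
      · exact Or.inr (Or.inl ⟨km h.1, kp h.2⟩)
      · exact Or.inr (Or.inr ⟨key0 h.1, kp h.2⟩)

/-- Approximation of a function that varies by at most `ε` on unit cells, on the box
`[1, N / 2 - 1]^s` with `N = B ^ 4`. -/
theorem exists_reach_box {s B : ℕ} (hs : 1 ≤ s) (hB : 0 < B) {H : (Fin s → ℝ) → ℝ} {ε : ℝ}
    (hε : 0 < ε)
    (hH : ∀ ξ ξ' D, 1 ≤ D → (∀ i, |ξ i - ξ' i| ≤ D) → |H ξ - H ξ'| ≤ ε * D) :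
    ∃ g : (Fin s → ℝ) → ℝ,
      Reach (3 ^ s * (22 * (s * B ^ s))) (3 * B ^ s + 9 + 2 * s) (affineFunctions s)
        (Submodule.span ℝ {g}) ∧
      ∀ ξ, (∀ i, 1 ≤ ξ i ∧ 2 * (ξ i + 1) ≤ ((B ^ 4 : ℕ) : ℝ)) → |g ξ - H ξ| ≤ (3 + s) * ε := by
  obtain ⟨g, hg, hgH⟩ := exists_reach_off_grid hs hB hε hH
  have hW : 0 < s * B ^ s := by positivity
  obtain ⟨g', hg', h⟩ := exists_reach_of_grid (by omega) hH hg hgH s le_rfl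
  exact ⟨g', hg', fun ξ hξ => h ξ (fun i _ => hξ i) fun i hi => by omega⟩

end Median

section Network

theorem Reach.sup_one {X : Type*} {W D : ℕ} {V U : Submodule ℝ (X → ℝ)} (h1 : (1 : X → ℝ) ∈ V)
    (h : Reach W D V U) : Reach W D V (U ⊔ Submodule.span ℝ {1}) := by
  induction D generalizing V with
  | zero => exact sup_le h (by simpa [Submodule.span_le] using h1)
  | succ D ih =>
    obtain ⟨f, hf, hr⟩ := h
    exact ⟨f, hf, ih (one_mem_affHull _) hr⟩

theorem Reach.mono_depth {X : Type*} {W D D' : ℕ} {V : Submodule ℝ (X → ℝ)} {g : X → ℝ}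
    (h1 : (1 : X → ℝ) ∈ V) (h : Reach W D V (Submodule.span ℝ {g})) (hW : 2 ≤ W) (hD : D ≤ D') :
    Reach W D' V (Submodule.span ℝ {g}) := by
  obtain ⟨k, rfl⟩ := Nat.exists_eq_add_of_le hD
  refine (h.sup_one h1).trans (((Reach.carry ?_ ?_).mono_width hW).mono_right
    (Submodule.span_mono (Set.subset_insert _ _)))
  · exact (le_sup_right : Submodule.span ℝ {(1 : X → ℝ)} ≤ _) (Submodule.mem_span_singleton_self _)
  · exact (le_sup_left : Submodule.span ℝ {g} ≤ _) (Submodule.mem_span_singleton_self _)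

theorem IsReluNet.mono_width {p W W' D : ℕ} {g : (Fin p → ℝ) → ℝ} (h : IsReluNet W D g)
    (hW : W ≤ W') : IsReluNet W' D g := by
  obtain ⟨dims, h0, hD, hdims, h⟩ := h
  exact ⟨dims, h0, hD, fun l h1 h2 => (hdims l h1 h2).trans hW, h⟩

theorem Reach.isReluNet_subvec {p s W D : ℕ} {g : (Fin s → ℝ) → ℝ}
    (h : Reach W D (affineFunctions s) (Submodule.span ℝ {g})) (S : Finset (Fin p))
    (hS : S.card = s) (a b : ℝ) :
    IsReluNet W D fun x => g fun i => a + b * subvec S hS x i := by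
  have hp := h.pull fun (x : Fin p → ℝ) i => a + b * subvec S hS x i
  obtain ⟨g', hg', e⟩ := hp.exists_isReluNet (fun i x => x i) (by
    rw [affineFunctions, map_affHull]
    refine affHull_le (one_mem_affHull _) ?_
    rintro _ ⟨_, ⟨i, rfl⟩, rfl⟩
    exact Submodule.add_mem _ (const_mem (one_mem_affHull _) a)
      (Submodule.smul_mem _ b (subset_affHull _ ⟨_, rfl⟩)))
    (Submodule.mem_map_of_mem (Submodule.mem_span_singleton_self _))
  convert hg' using 1
  exact funext e

theorem euclNorm_le {s : ℕ} {v : Fin s → ℝ} {D : ℝ} (hD : 0 ≤ D) (hv : ∀ i, |v i| ≤ D) :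
    euclNorm v ≤ s * D := by
  refine Real.sqrt_le_iff.2 ⟨by positivity, ?_⟩
  calc ∑ i, v i ^ 2 ≤ ∑ _i : Fin s, D ^ 2 :=
        Finset.sum_le_sum fun i _ => sq_le_sq.2 (by rw [abs_of_nonneg hD]; exact hv i)
    _ = s * D ^ 2 := by simp
    _ ≤ (s : ℝ) ^ 2 * D ^ 2 := by
        gcongr
        exact_mod_cast Nat.le_self_pow two_ne_zero s
    _ = (s * D) ^ 2 := by ring

theorem rpow_rate {s n : ℕ} (hs : 1 ≤ s) (hn : 1 ≤ n) {β m C₃ K u : ℝ} (hβ : 0 < β) (hm : 0 < m)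
    (hC : 0 < C₃) (hmC : m ≤ C₃ * (n : ℝ) ^ ((1 : ℝ) / s)) (hK : 0 < K)
    (hu : (n : ℝ) ^ ((2 * β + s) / (8 * β)) ≤ u) :
    (K * m / u ^ ((4 : ℝ) / s)) ^ β ≤ (K * C₃) ^ β * (n : ℝ) ^ (-(1 : ℝ) / 2) := by
  have hn0 : (0 : ℝ) < n := by exact_mod_cast hn
  have hs0 : (0 : ℝ) < s := by exact_mod_cast hs
  have hu0 : 0 < u := lt_of_lt_of_le (by positivity) hu
  have h1 : (n : ℝ) ^ ((2 * β + s) / (8 * β) * (4 / s)) ≤ u ^ ((4 : ℝ) / s) := by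
    rw [Real.rpow_mul hn0.le]
    gcongr
  calc (K * m / u ^ ((4 : ℝ) / s)) ^ β
      ≤ (K * (C₃ * (n : ℝ) ^ ((1 : ℝ) / s)) /
          (n : ℝ) ^ ((2 * β + s) / (8 * β) * (4 / s))) ^ β := by gcongr
    _ = (K * C₃ * (n : ℝ) ^ ((1 : ℝ) / s - (2 * β + s) / (8 * β) * (4 / s))) ^ β := by
        rw [Real.rpow_sub hn0]
        congr 1
        ring
    _ = (K * C₃) ^ β * (n : ℝ) ^ (-(1 : ℝ) / 2) := by
        rw [Real.mul_rpow (by positivity) (by positivity), ← Real.rpow_mul hn0.le]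
        congr 2
        field_simp
        ring

theorem exists_base {s w : ℕ} (hs : 1 ≤ s) (hw : s * 2 ^ s ≤ w) :
    ∃ B : ℕ, 2 ≤ B ∧ s * B ^ s ≤ w ∧
      ((w : ℝ) / s) ^ ((4 : ℝ) / s) ≤ 16 * (B : ℝ) ^ 4 := by
  have hs0 : (0 : ℝ) < s := by exact_mod_cast hs
  have hw' : (2 : ℝ) ^ s ≤ (w : ℝ) / s := by
    rw [le_div_iff₀ hs0, mul_comm]
    exact_mod_cast hw
  have hw0 : 0 ≤ (w : ℝ) / s := by positivity
  set x := ((w : ℝ) / s) ^ ((1 : ℝ) / s) with hx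
  have hx0 : 0 ≤ x := by positivity
  have hxs : x ^ s = (w : ℝ) / s := by
    rw [hx, one_div, Real.rpow_inv_natCast_pow hw0 (by omega)]
  have hx2 : 2 ≤ x := le_of_pow_le_pow_left₀ (n := s) (by omega) hx0 (hxs ▸ hw')
  refine ⟨⌊x⌋₊, Nat.le_floor (by simpa using hx2), ?_, ?_⟩
  · have h : (⌊x⌋₊ : ℝ) ^ s ≤ (w : ℝ) / s := hxs ▸ pow_le_pow_left₀ (by positivity)
      (Nat.floor_le hx0) s
    rw [le_div_iff₀ hs0, mul_comm] at h
    exact_mod_cast h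
  · have h1 := Nat.lt_floor_add_one x
    have h2 : x ≤ 2 * ⌊x⌋₊ := by linarith
    calc ((w : ℝ) / s) ^ ((4 : ℝ) / s) = x ^ 4 := by
          rw [hx, ← Real.rpow_natCast, ← Real.rpow_mul hw0]
          congr 1
          push_cast
          ring
      _ ≤ (2 * (⌊x⌋₊ : ℝ)) ^ 4 := by gcongr
      _ = 16 * (⌊x⌋₊ : ℝ) ^ 4 := by ring

theorem exists_isReluNet_holder {s p : ℕ} (hs : 1 ≤ s) {β C₀ : ℝ} (hβ0 : 0 < β) (hβ1 : β ≤ 1)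
    (hC₀ : 0 < C₀) (S : Finset (Fin p)) (hS : S.card = s) {G : (Fin s → ℝ) → ℝ}
    (hG : ∀ z z' : Fin s → ℝ, |G z - G z'| ≤ C₀ * euclNorm (z - z') ^ β) (w : ℕ) {m : ℝ}
    (hm : 0 < m) :
    ∃ g : (Fin s → ℝ) → ℝ,
      IsReluNet (3 ^ (s + 3) * (w + 1)) (12 * w + 14 + 2 * s) (fun x => g (subvec S hS x)) ∧
      ∀ z, (∀ i, |z i| ≤ m) → |G z - g z| ≤ (3 + s) * (C₀ *
        (128 * s * (s : ℝ) ^ ((4 : ℝ) / s) * m /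
          (max w (s * 2 ^ s) : ℕ) ^ ((4 : ℝ) / s)) ^ β) := by
  have hs0 : (0 : ℝ) < s := by exact_mod_cast hs
  have h3 : 1 ≤ 3 ^ s := Nat.one_le_pow _ _ (by norm_num)
  have hW2 : 2 ≤ 3 ^ (s + 3) * (w + 1) := by
    rw [pow_add]
    nlinarith
  have hG' : ∀ z z' D, 0 ≤ D → (∀ i, |z i - z' i| ≤ D) → |G z - G z'| ≤ C₀ * (s * D) ^ β :=
    fun z z' D hD h => (hG z z').trans (by
      have h1 := euclNorm_le (v := z - z') hD h
      have h2 : 0 ≤ euclNorm (z - z') := Real.sqrt_nonneg _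
      gcongr)
  have one : (1 : (Fin s → ℝ) → ℝ) ∈ affineFunctions s := one_mem_affHull _
  rcases lt_or_ge w (s * 2 ^ s) with hw | hw
  · refine ⟨fun _ => G 0, ?_, fun z hz => ?_⟩
    · have h : Reach 2 (12 * w + 14 + 2 * s) (affineFunctions s)
          (Submodule.span ℝ {fun _ => G 0}) :=
        (Reach.carry one (const_mem one (G 0))).mono_right
          (Submodule.span_mono (Set.subset_insert _ _))
      simpa using (h.mono_width hW2).isReluNet_subvec S hS 0 1
    · have h1 := hG' z 0 m hm.le (by simpa using hz)
      have h2 : (s : ℝ) * m ≤ 128 * s * (s : ℝ) ^ ((4 : ℝ) / s) * m /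
          (max w (s * 2 ^ s) : ℕ) ^ ((4 : ℝ) / s) := by
        have e : ((2 : ℝ) ^ s) ^ ((4 : ℝ) / s) = 16 := by
          rw [← Real.rpow_natCast, ← Real.rpow_mul (by norm_num), mul_div_cancel₀ _ hs0.ne']
          norm_num
        rw [max_eq_right hw.le]
        push_cast
        rw [Real.mul_rpow hs0.le (by positivity), e, le_div_iff₀ (by positivity)]
        have : 0 < s * m * (s : ℝ) ^ ((4 : ℝ) / s) := by positivity
        linarith
      calc |G z - G 0| ≤ 1 * (C₀ * (s * m) ^ β) := by simpa using h1
        _ ≤ _ := by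
          gcongr
          linarith
  · obtain ⟨B, hB2, hBw, hBx⟩ := exists_base hs hw
    have hB16 : 16 ≤ (B : ℝ) ^ 4 := by
      exact_mod_cast Nat.pow_le_pow_left hB2 4
    have hB0 : (0 : ℝ) < (B : ℝ) ^ 4 := by linarith
    set N : ℝ := (B : ℝ) ^ 4 with hN
    set h : ℝ := 8 * m / N with hh
    have hh0 : 0 < h := by positivity
    let H : (Fin s → ℝ) → ℝ := fun ξ => G fun i => h * (ξ i - N / 4)
    have hH : ∀ ξ ξ' D, 1 ≤ D → (∀ i, |ξ i - ξ' i| ≤ D) →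
        |H ξ - H ξ'| ≤ C₀ * (s * h) ^ β * D := by
      intro ξ ξ' D hD hξ
      have h1 := hG' (fun i => h * (ξ i - N / 4)) (fun i => h * (ξ' i - N / 4)) (h * D)
        (by positivity) fun i => by
          rw [← mul_sub, sub_sub_sub_cancel_right, abs_mul, abs_of_pos hh0]
          exact mul_le_mul_of_nonneg_left (hξ i) hh0.le
      refine h1.trans ?_
      rw [← mul_assoc, Real.mul_rpow (by positivity) (by positivity), ← mul_assoc]
      gcongr
      simpa using Real.rpow_le_rpow_of_exponent_le hD hβ1
    obtain ⟨g, hg, hgH⟩ := exists_reach_box (B := B) hs (by omega)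
      (ε := C₀ * (s * h) ^ β) (by positivity) hH
    refine ⟨fun z => g fun i => N / 4 + h⁻¹ * z i, ?_, fun z hz => ?_⟩
    · refine ((hg.mono_width ?_).mono_depth one hW2 ?_).isReluNet_subvec S hS (N / 4) h⁻¹
      · rw [pow_add, mul_assoc]
        exact Nat.mul_le_mul_left _ (by omega)
      · have : B ^ s ≤ s * B ^ s := Nat.le_mul_of_pos_left _ hs
        omega
    · have h1 := hgH (fun i => N / 4 + h⁻¹ * z i) fun i => by
        have h2 : |h⁻¹ * z i| ≤ N / 8 := by
          rw [abs_mul, abs_of_pos (inv_pos.2 hh0)]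
          calc h⁻¹ * |z i| ≤ h⁻¹ * m := by
                have := hz i
                gcongr
            _ = N / 8 := by
                rw [hh]
                field_simp
        have h4 := abs_le.1 h2
        push_cast
        constructor <;> linarith
      have e : H (fun i => N / 4 + h⁻¹ * z i) = G z := by
        simp only [H]
        congr 1
        ext i
        field_simp
        ring
      rw [e, abs_sub_comm] at h1
      refine h1.trans ?_
      have hw0 : (0 : ℝ) < w := by
        have : 0 < s * 2 ^ s := by positivity
        exact_mod_cast this.trans_le hw
      have h5 : (s : ℝ) * h ≤ 128 * s * (s : ℝ) ^ ((4 : ℝ) / s) * m / (w : ℝ) ^ ((4 : ℝ) / s) := by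
        rw [Real.div_rpow hw0.le hs0.le, div_le_iff₀ (by positivity)] at hBx
        rw [hh, ← mul_div_assoc, div_le_div_iff₀ hB0 (by positivity)]
        calc s * (8 * m) * (w : ℝ) ^ ((4 : ℝ) / s)
            ≤ s * (8 * m) * (16 * N * (s : ℝ) ^ ((4 : ℝ) / s)) := by gcongr
          _ = _ := by ring
      rw [max_eq_left hw]
      gcongr

end Network

/-- For a `β`-Hölder function `G : ℝ^s → ℝ` with constant `C₀` and a fixed
`C₃ > 0`, there is `C > 0` such that for every `n ≥ 1` and `0 < m ≤ C₃ n^{1/s}`, taking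
`w = d = ⌈n^{(2β+s)/(8β)}⌉`, there is a ReLU network `g : ℝ^p → ℝ` of width
`3^{s+3} max{s⌊w^{1/s}⌋, w+1}` and depth `12d + 14 + 2s`, depending on `x` only through
`x_{S₀}`, with `sup_{x_{S₀} ∈ [−m,m]^s} |G(x_{S₀}) − g(x)| ≤ C n^{−1/2}`. -/
theorem stmt11 (s : ℕ) (hs : 1 ≤ s) (β C₀ : ℝ) (hβ0 : 0 < β) (hβ1 : β ≤ 1) (hC₀ : 0 < C₀)
    (p : ℕ) (S₀ : Finset (Fin p)) (hcard : S₀.card = s)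
    (G : (Fin s → ℝ) → ℝ)
    (hG : ∀ z z' : Fin s → ℝ, |G z - G z'| ≤ C₀ * euclNorm (z - z') ^ β)
    (C₃ : ℝ) (hC₃ : 0 < C₃) :
    ∃ C : ℝ, 0 < C ∧
      ∀ n : ℕ, 1 ≤ n → ∀ m : ℝ, 0 < m → m ≤ C₃ * (n : ℝ) ^ ((1 : ℝ) / s) →
        ∃ g : (Fin p → ℝ) → ℝ,
          IsReluNet
            (3 ^ (s + 3) *
              max (s * ⌊(wdParam n s β : ℝ) ^ ((1 : ℝ) / s)⌋₊) (wdParam n s β + 1))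
            (12 * wdParam n s β + 14 + 2 * s) g ∧
          (∀ x x' : Fin p → ℝ, subvec S₀ hcard x = subvec S₀ hcard x' → g x = g x') ∧
          ∀ x : Fin p → ℝ, (∀ i, |subvec S₀ hcard x i| ≤ m) →
            |G (subvec S₀ hcard x) - g x| ≤ C * (n : ℝ) ^ (-(1 : ℝ) / 2) := by
  have hs0 : (0 : ℝ) < s := by exact_mod_cast hs
  set K : ℝ := 128 * s * (s : ℝ) ^ ((4 : ℝ) / s) with hK
  have hK0 : 0 < K := by positivity
  refine ⟨(3 + s) * (C₀ * (K * C₃) ^ β), by positivity, fun n hn m hm hmC => ?_⟩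
  obtain ⟨g, hg, hgG⟩ :=
    exists_isReluNet_holder hs hβ0 hβ1 hC₀ S₀ hcard hG (wdParam n s β) hm
  refine ⟨_, hg.mono_width (Nat.mul_le_mul_left _ (le_max_right _ _)),
    fun x x' h => congrArg g h, fun x hx => (hgG _ hx).trans ?_⟩
  have hrate := rpow_rate (u := (max (wdParam n s β) (s * 2 ^ s) : ℕ)) hs hn hβ0 hm hC₃ hmC hK0
    ((Nat.le_ceil _).trans (by exact_mod_cast le_max_left _ _))
  calc _ ≤ (3 + s) * (C₀ * ((K * C₃) ^ β * (n : ℝ) ^ (-(1 : ℝ) / 2))) := by gcongr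
    _ = _ := by ring
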